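/- arXiv:2501.06200 — 3 statements merged into one kernel-verified Lean document; each statement's English description precedes it below -/
import Mathlib

section
/- Let F be a field of characteristic different from 2, V a finite-dimensional F-vector space of dimension n, and Q a quadratic form on V whose associated polar bilinear form is nondegenerate. Then there exists a finite Galois field extension L/F whose degree [L:F] is a power of 2, together with an L-linear subspace W of the base change V ⊗_F L with dim_L W = ⌊n/2⌋, such that the base-changed quadratic form Q_L vanishes on every vector of W (i.e., W is a totally isotropic subspace of maximal dimension, so Q_L is split). -/
open scoped TensorProduct

universe u

open Polynomial in
/-- Over a field of characteristic `≠ 2`, finitely many nonzero elements acquire square roots in a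
common finite Galois extension of degree a power of `2`. -/
theorem exists_isGalois_two_power_forall_isSquare {F : Type u} [Field F] (h2 : (2 : F) ≠ 0)
    (s : Finset F) (hs : ∀ a ∈ s, a ≠ 0) :
    ∃ (L : Type u) (_ : Field L) (_ : Algebra F L),
      IsGalois F L ∧ FiniteDimensional F L ∧ (∃ m : ℕ, Module.finrank F L = 2 ^ m) ∧
      ∀ a ∈ s, ∃ c : L, c ^ 2 = algebraMap F L a := by
  let p : F[X] := ∏ a ∈ s, (X ^ 2 - C a)
  have hsep : p.Separable := by
    refine separable_prod' (fun a _ b _ hab => ?_) fun a ha =>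
      separable_X_pow_sub_C a (by exact_mod_cast h2) (hs a ha)
    refine ⟨C (b - a)⁻¹, -C (b - a)⁻¹, ?_⟩
    have hba : b - a ≠ 0 := sub_ne_zero.mpr hab.symm
    calc C (b - a)⁻¹ * (X ^ 2 - C a) + -C (b - a)⁻¹ * (X ^ 2 - C b)
        = C ((b - a)⁻¹ * (b - a)) := by rw [C_mul, C_sub]; ring
      _ = 1 := by rw [inv_mul_cancel₀ hba, C_1]
  have hgal : IsGalois F p.SplittingField := IsGalois.of_separable_splitting_field hsep
  refine ⟨p.SplittingField, inferInstance, inferInstance, hgal, inferInstance, ?_, fun a ha => ?_⟩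
  · have hpow : ∀ σ : Gal(p.SplittingField/F), σ ^ 2 = 1 := by
      intro σ
      have key : (σ : p.SplittingField →ₐ[F] p.SplittingField).comp σ = AlgHom.id F _ := by
        refine AlgHom.ext_of_adjoin_eq_top (SplittingField.adjoin_rootSet p) fun x hx => ?_
        have hx0 : aeval x (∏ a ∈ s, (X ^ 2 - C a)) = 0 := (mem_rootSet.mp hx).2
        rw [map_prod, Finset.prod_eq_zero_iff] at hx0
        obtain ⟨a, -, ha⟩ := hx0
        have hxa : x ^ 2 = algebraMap F _ a := by simpa [sub_eq_zero] using ha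
        have hσ : (σ x) ^ 2 = x ^ 2 := by rw [← map_pow, hxa, AlgEquiv.commutes]
        rcases sq_eq_sq_iff_eq_or_eq_neg.mp hσ with h | h <;> simp [h]
      ext x
      simpa [pow_two] using DFunLike.congr_fun key x
    rw [← IsGalois.card_aut_eq_finrank]
    exact IsPGroup.iff_card.mp fun σ => ⟨1, by simpa using hpow σ⟩
  · have hdvd : (X ^ 2 - C a) ∣ p := Finset.dvd_prod_of_mem _ ha
    have hspl := (SplittingField.splits p).of_dvd
      (map_ne_zero hsep.ne_zero) (map_dvd (mapRingHom (algebraMap F p.SplittingField)) hdvd)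
    obtain ⟨c, hc⟩ := hspl.exists_eval_eq_zero (by
      simp only [coe_mapRingHom, degree_map]
      rw [degree_X_pow_sub_C two_pos]; decide)
    exact ⟨c, by simpa [sub_eq_zero] using hc⟩

/-- A quadratic form that is diagonal in a basis indexed by `ι ⊕ ι ⊕ κ`, with the first two blocks
of coefficients satisfying `c i ^ 2 * Q (b i) = - Q (b i')`, has a totally isotropic subspace of
dimension `|ι|`. -/
theorem QuadraticForm.exists_isotropic_of_iIsOrtho {K V ι κ : Type*} [Field K]
    [Invertible (2 : K)] [AddCommGroup V] [Module K V] [Fintype ι] [Fintype κ]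
    (Q : QuadraticForm K V) (b : Module.Basis (ι ⊕ ι ⊕ κ) K V)
    (hb : (QuadraticMap.associated (R := K) Q).IsOrthoᵢ b) (c : ι → K)
    (hc : ∀ i, c i ^ 2 * Q (b (.inl i)) = -Q (b (.inr (.inl i)))) :
    ∃ W : Submodule K V, Module.finrank K W = Fintype.card ι ∧ ∀ w ∈ W, Q w = 0 := by
  let g : (ι → K) →ₗ[K] (ι ⊕ ι ⊕ κ → K) :=
    { toFun := fun x => Sum.elim (fun i => c i * x i) (Sum.elim x 0)
      map_add' := fun x y => by ext (i | i | i) <;> simp [mul_add]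
      map_smul' := fun r x => by ext (i | i | i) <;> simp [mul_left_comm] }
  have hg : Function.Injective g := fun x y hxy =>
    funext fun i => congrFun hxy (.inr (.inl i))
  let f : (ι → K) →ₗ[K] V := b.equivFun.symm.toLinearMap ∘ₗ g
  refine ⟨LinearMap.range f, ?_, ?_⟩
  · rw [LinearMap.finrank_range_of_inj (f := f) (b.equivFun.symm.injective.comp hg),
      Module.finrank_fintype_fun_eq_card]
  · rintro _ ⟨x, rfl⟩
    have h : Q (f x) = Q.basisRepr b (g x) := rfl
    rw [h, QuadraticMap.basisRepr_eq_of_iIsOrtho Q b hb, QuadraticMap.weightedSumSquares_apply]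
    simp only [Fintype.sum_sum_type, g, LinearMap.coe_mk, AddHom.coe_mk, Sum.elim_inl,
      Sum.elim_inr, Pi.zero_apply, mul_zero, Finset.sum_const_zero, add_zero,
      smul_eq_mul]
    rw [← Finset.sum_add_distrib]
    exact Finset.sum_eq_zero fun i _ => by linear_combination x i ^ 2 * hc i

/-- Any nondegenerate quadratic form over a field of characteristic `≠ 2` splits over
some finite Galois extension of degree a power of `2`: there is a finite Galois
extension `L/F` with `[L : F] = 2 ^ m` and a totally isotropic `L`-subspace of
`L ⊗[F] V` of the maximal dimension `⌊n / 2⌋`. -/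
theorem quadratic_form_split_over_two_power_galois_extension
    (F : Type) [Field F] (h2 : (2 : F) ≠ 0)
    (V : Type) [AddCommGroup V] [Module F V] [FiniteDimensional F V]
    (n : ℕ) (hn : Module.finrank F V = n)
    (Q : QuadraticForm F V)
    (hQ : (QuadraticMap.polarBilin Q).Nondegenerate) :
    letI : Invertible (2 : F) := invertibleOfNonzero h2
    ∃ (L : Type) (_ : Field L) (_ : Algebra F L),
      IsGalois F L ∧ FiniteDimensional F L ∧ (∃ m : ℕ, Module.finrank F L = 2 ^ m) ∧
      ∃ W : Submodule L (L ⊗[F] V),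
        Module.finrank L W = n / 2 ∧
        ∀ w ∈ W, Q.baseChange L w = 0 := by
  let : Invertible (2 : F) := invertibleOfNonzero h2
  have hsepL : (QuadraticMap.associated (R := F) Q).SeparatingLeft := fun x hx =>
    hQ.1 x fun y => by
      rw [← QuadraticMap.two_nsmul_associated F Q, LinearMap.smul_apply, LinearMap.smul_apply,
        hx y, smul_zero]
  obtain ⟨v, hv⟩ := LinearMap.BilinForm.exists_orthogonal_basis
    (B := QuadraticMap.associated (R := F) Q) ⟨QuadraticMap.associated_isSymm F Q⟩
  let e : Fin (Module.finrank F V) ≃ Fin (n / 2) ⊕ Fin (n / 2) ⊕ Fin (n % 2) :=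
    Fintype.equivOfCardEq (by simp only [Fintype.card_sum, Fintype.card_fin]; omega)
  let b := v.reindex e
  have hb : (QuadraticMap.associated (R := F) Q).IsOrthoᵢ b := fun i j hij => by
    simpa [b, Function.onFun] using hv (e.symm.injective.ne hij)
  have hne : ∀ i, Q (b i) ≠ 0 := fun i => by
    rw [← QuadraticMap.associated_eq_self_apply F Q]
    exact hb.not_isOrtho_basis_self_of_separatingLeft hsepL i
  classical
  let a : Fin (n / 2) → F := fun i => -Q (b (.inr (.inl i))) / Q (b (.inl i))
  obtain ⟨L, hL, hFL, hgal, hfin, hdeg, hsq⟩ := exists_isGalois_two_power_forall_isSquare h2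
    (Finset.univ.image a) (by
      simp only [Finset.mem_image, Finset.mem_univ, true_and, forall_exists_index,
        forall_apply_eq_imp_iff]
      exact fun i => div_ne_zero (neg_ne_zero.mpr (hne _)) (hne _))
  refine ⟨L, hL, hFL, hgal, hfin, hdeg, ?_⟩
  choose c hc using fun i => hsq (a i) (Finset.mem_image_of_mem a (Finset.mem_univ i))
  let : Invertible (2 : L) := (Invertible.map (algebraMap F L) 2).copy 2 (map_ofNat _ 2).symm
  have key := QuadraticForm.exists_isotropic_of_iIsOrtho (Q.baseChange L) (b.baseChange L)
    (fun i j hij => by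
      have h : QuadraticMap.associated (R := F) Q (b i) (b j) = 0 := hb hij
      rw [Function.onFun, QuadraticForm.associated_baseChange]
      simp [h])
    c (fun i => by
      have h : a i * Q (b (.inl i)) = -Q (b (.inr (.inl i))) := div_mul_cancel₀ _ (hne _)
      rw [hc]
      simp only [Module.Basis.baseChange_apply, QuadraticForm.baseChange_tmul, mul_one,
        Algebra.smul_def]
      rw [← map_mul, h, map_neg])
  simpa using key
end

section
/- Let A be a torsion-free abelian group, let G be a finite group of order m acting on A by group automorphisms, and let R be a subgroup of A such that (i) every element of R is fixed by the action of G, and (ii) m·x ∈ R for every G-fixed element x ∈ A. Then a G-fixed element u ∈ A belongs to R if and only if there exists v ∈ R with u − v ∈ m·A. -/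
/-- Let `A` be a torsion-free abelian group with an action of a finite group `G` of
order `m` by group automorphisms, and let `R` be a subgroup of `A` consisting of
`G`-fixed elements and containing `m • x` for every `G`-fixed `x`. Then a `G`-fixed
element `u` lies in `R` iff `u ≡ v mod m • A` for some `v ∈ R`. -/
theorem fixed_mem_subgroup_iff_mod_card
    {A : Type*} [AddCommGroup A] {G : Type*} [Group G] [Finite G]
    [DistribMulAction G A] (m : ℕ) (hm : Nat.card G = m)
    (htf : ∀ (a : A) (n : ℕ), n ≠ 0 → n • a = 0 → a = 0)
    (R : AddSubgroup A)
    (hfix : ∀ r ∈ R, ∀ γ : G, γ • r = r)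
    (hmul : ∀ x : A, (∀ γ : G, γ • x = x) → m • x ∈ R)
    (u : A) (hu : ∀ γ : G, γ • u = u) :
    u ∈ R ↔ ∃ v ∈ R, ∃ a : A, u - v = m • a := by
  have hm0 : m ≠ 0 := hm ▸ Nat.card_pos.ne'
  refine ⟨fun h => ⟨u, h, 0, by simp⟩, ?_⟩
  rintro ⟨v, hv, a, ha⟩
  have ha_fixed : ∀ γ : G, γ • a = a := fun γ => by
    refine sub_eq_zero.mp (htf _ m hm0 ?_)
    rw [smul_sub, ← smul_comm γ m a, ← ha, smul_sub, hu γ, hfix v hv γ, sub_self]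
  rw [← sub_add_cancel u v, ha]
  exact R.add_mem (hmul a ha_fixed) hv
end

section
/- Let L/F be a finite Galois field extension with Galois group G = Gal(L/F), let F̄ be an algebraic closure of F, and let τ : L → F̄ be an F-algebra embedding. Then the F̄-algebra homomorphism L ⊗_F F̄ → (G → F̄) determined by u ⊗ a ↦ (γ ↦ a · τ(γ(u))) (for u ∈ L, a ∈ F̄, γ ∈ G) is bijective, i.e., it is an isomorphism of F̄-algebras from L ⊗_F F̄ onto the product of copies of F̄ indexed by the elements of G. -/
open scoped TensorProduct

attribute [local instance] Algebra.TensorProduct.rightAlgebra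

/-- Dedekind independence: the vectors `(τ (γ u))_γ`, for `u` in `L`, span the space of functions
on the automorphism group. -/
theorem span_range_algHom_comp_algEquiv_eq_top {F L E : Type*} [Field F] [Field L] [Algebra F L]
    [FiniteDimensional F L] [Field E] [Algebra F E] (τ : L →ₐ[F] E) :
    Submodule.span E (Set.range fun (u : L) (γ : L ≃ₐ[F] L) ↦ τ (γ u)) = ⊤ := by
  have h : LinearIndependent E fun (γ : L ≃ₐ[F] L) (u : L) ↦ τ (γ u) :=
    (linearIndependent_monoidHom L E).comp
      (fun γ : L ≃ₐ[F] L ↦ ((τ.comp (γ : L →ₐ[F] L) : L →ₐ[F] E) : L →* E))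
      fun γ δ hγδ ↦ AlgEquiv.ext fun u ↦ τ.injective (DFunLike.congr_fun hγδ u)
  exact span_flip_eq_top_iff_linearIndependent.mpr h

/-- The `E`-algebra homomorphism `E ⊗ L → (Gal(L/F) → E)` sending `a ⊗ u` to
`γ ↦ a * τ (γ u)`. -/
noncomputable def baseChangeToPi {F L E : Type*} [Field F] [Field L] [Algebra F L]
    [Field E] [Algebra F E] (τ : L →ₐ[F] E) : E ⊗[F] L →ₐ[E] ((L ≃ₐ[F] L) → E) :=
  Algebra.TensorProduct.lift (Algebra.ofId E _)
    (AlgHom.pi fun γ : L ≃ₐ[F] L ↦ τ.comp (γ : L →ₐ[F] L)) fun _ _ ↦ Commute.all _ _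

theorem baseChangeToPi_tmul {F L E : Type*} [Field F] [Field L] [Algebra F L]
    [Field E] [Algebra F E] (τ : L →ₐ[F] E) (a : E) (u : L) (γ : L ≃ₐ[F] L) :
    baseChangeToPi τ (a ⊗ₜ u) γ = a * τ (γ u) := by
  simp [baseChangeToPi, Algebra.ofId_apply]

theorem baseChangeToPi_surjective {F L E : Type*} [Field F] [Field L] [Algebra F L]
    [FiniteDimensional F L] [Field E] [Algebra F E] (τ : L →ₐ[F] E) :
    Function.Surjective (baseChangeToPi τ) := by
  have h : LinearMap.range (baseChangeToPi τ).toLinearMap = ⊤ := by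
    rw [eq_top_iff, ← span_range_algHom_comp_algEquiv_eq_top τ, Submodule.span_le]
    rintro _ ⟨u, rfl⟩
    exact ⟨1 ⊗ₜ u, funext fun γ ↦ by simp [baseChangeToPi_tmul]⟩
  exact LinearMap.range_eq_top.mp h

theorem baseChangeToPi_bijective {F L E : Type*} [Field F] [Field L] [Algebra F L]
    [FiniteDimensional F L] [IsGalois F L] [Field E] [Algebra F E] (τ : L →ₐ[F] E) :
    Function.Bijective (baseChangeToPi τ) := by
  have hrank : Module.finrank E (E ⊗[F] L) = Module.finrank E ((L ≃ₐ[F] L) → E) := by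
    rw [Module.finrank_baseChange, Module.finrank_fintype_fun_eq_card, ← Nat.card_eq_fintype_card,
      IsGalois.card_aut_eq_finrank]
  exact ⟨(LinearMap.injective_iff_surjective_of_finrank_eq_finrank hrank
    (f := (baseChangeToPi τ).toLinearMap)).mpr (baseChangeToPi_surjective τ),
    baseChangeToPi_surjective τ⟩

/-- For a finite Galois extension `L/F` with Galois group `G = L ≃ₐ[F] L`, an algebraic
closure `F̄` of `F` and an `F`-embedding `τ : L → F̄`, the `F̄`-algebra homomorphism
`L ⊗[F] F̄ → (G → F̄)` determined by `u ⊗ a ↦ (γ ↦ a * τ (γ u))` is bijective. -/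
theorem tensor_algClosure_iso_pi_galois
    (F L Fbar : Type) [Field F] [Field L] [Algebra F L]
    [FiniteDimensional F L] [IsGalois F L]
    [Field Fbar] [Algebra F Fbar] [IsAlgClosure F Fbar]
    (τ : L →ₐ[F] Fbar) :
    ∃ f : L ⊗[F] Fbar →ₐ[Fbar] ((L ≃ₐ[F] L) → Fbar),
      (∀ (u : L) (a : Fbar) (γ : L ≃ₐ[F] L), f (u ⊗ₜ a) γ = a * τ (γ u)) ∧
      Function.Bijective f := by
  let e := (Algebra.TensorProduct.commRight F Fbar L).symm
  exact ⟨(baseChangeToPi τ).comp (e : L ⊗[F] Fbar →ₐ[Fbar] Fbar ⊗[F] L),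
    fun u a γ ↦ baseChangeToPi_tmul τ a u γ, (baseChangeToPi_bijective τ).comp e.bijective⟩
end
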